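/- Assume G is orderable and φ is cofinal. Then the spectral pseudo-distance d_spec satisfies: d_spec(x, x) = 0 and d_spec(x, y) ≥ 0 for all x, y; d_spec(x, y) = d_spec(y, x); d_spec(x, z) ≤ d_spec(x, y) + d_spec(y, z); right-invariance d_spec(x*g, y*g) = d_spec(x, y) for all g ∈ G; and the partially ordered metric space property: a ⪯ b and b ⪯ c imply d_spec(a, b) ≤ d_spec(a, c). (The spectral pseudo-metric and Proposition 3.9 of the paper.) -/

import Mathlib

/-- The maximal order spectral selector `c₊`. -/
noncomputable def cplus {G : Type*} (r : G → G → Prop) (φ : ℝ → G) (ψ : G) : ℝ :=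
  sInf {t : ℝ | r ψ (φ t)}

/-- The spectral pseudo-distance `d_spec(x, y) = max (c₊(x*y⁻¹), c₊(y*x⁻¹))`. -/
noncomputable def dSpec {G : Type*} [Group G] (r : G → G → Prop) (φ : ℝ → G) (x y : G) : ℝ :=
  max (cplus r φ (x * y⁻¹)) (cplus r φ (y * x⁻¹))

section Selector

variable {G : Type*} {r : G → G → Prop} {φ : ℝ → G}

theorem le_of_rel_flow (hφinj : Function.Injective φ)
    (hφmono : ∀ s t : ℝ, s ≤ t → r (φ s) (φ t))
    (horder : ∀ x y, r x y → r y x → x = y) {s t : ℝ} (h : r (φ s) (φ t)) : s ≤ t := by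
  by_contra! hlt
  exact hlt.ne (hφinj (horder _ _ (hφmono _ _ hlt.le) h))

theorem bddBelow_setOf_rel_flow (htrans : ∀ x y z, r x y → r y z → r x z)
    (hφinj : Function.Injective φ) (hφmono : ∀ s t : ℝ, s ≤ t → r (φ s) (φ t))
    (horder : ∀ x y, r x y → r y x → x = y)
    (hcof : ∀ ψ : G, ∃ s t : ℝ, r (φ s) ψ ∧ r ψ (φ t)) (ψ : G) :
    BddBelow {t : ℝ | r ψ (φ t)} := by
  obtain ⟨s, -, hs, -⟩ := hcof ψ
  exact ⟨s, fun _ ht => le_of_rel_flow hφinj hφmono horder (htrans _ _ _ hs ht)⟩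

theorem cplus_mono (htrans : ∀ x y z, r x y → r y z → r x z)
    (hbdd : ∀ ψ, BddBelow {t : ℝ | r ψ (φ t)})
    (hne : ∀ ψ, {t : ℝ | r ψ (φ t)}.Nonempty) {ψ ψ' : G} (h : r ψ ψ') :
    cplus r φ ψ ≤ cplus r φ ψ' :=
  csInf_le_csInf (hbdd ψ) (hne ψ') fun _ ht => htrans _ _ _ h ht

theorem cplus_flow (hφinj : Function.Injective φ)
    (hφmono : ∀ s t : ℝ, s ≤ t → r (φ s) (φ t))
    (horder : ∀ x y, r x y → r y x → x = y) (s : ℝ) : cplus r φ (φ s) = s := by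
  have : {t : ℝ | r (φ s) (φ t)} = Set.Ici s :=
    Set.ext fun t => ⟨le_of_rel_flow hφinj hφmono horder, hφmono s t⟩
  rw [cplus, this, csInf_Ici]

theorem cplus_mul_le [Group G] (htrans : ∀ x y z, r x y → r y z → r x z)
    (hbi : ∀ a b x y, r x y → r (a * x * b) (a * y * b))
    (hφadd : ∀ s t : ℝ, φ (s + t) = φ s * φ t)
    (hbdd : ∀ ψ, BddBelow {t : ℝ | r ψ (φ t)})
    (hne : ∀ ψ, {t : ℝ | r ψ (φ t)}.Nonempty) (x y : G) :
    cplus r φ (x * y) ≤ cplus r φ x + cplus r φ y := by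
  have key : ∀ s t : ℝ, r x (φ s) → r y (φ t) → cplus r φ (x * y) ≤ s + t := by
    intro s t hs ht
    refine csInf_le (hbdd _) ?_
    rw [Set.mem_ofPred_eq, hφadd]
    exact htrans _ _ _ (by simpa using hbi 1 y _ _ hs) (by simpa using hbi (φ s) 1 _ _ ht)
  rw [← sub_le_iff_le_add]
  refine le_csInf (hne x) fun s hs => ?_
  rw [sub_le_comm]
  exact le_csInf (hne y) fun t ht => by linarith [key s t hs ht]

end Selector

/-- the spectral pseudo-distance is a right-invariant
pseudo-metric endowing `(G, ⪯)` with a partially ordered metric space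
structure. -/
theorem stmt_11 {G : Type*} [Group G] (r : G → G → Prop)
    (hrefl : ∀ x, r x x)
    (htrans : ∀ x y z, r x y → r y z → r x z)
    (hbi : ∀ a b x y, r x y → r (a * x * b) (a * y * b))
    (φ : ℝ → G)
    (hφadd : ∀ s t : ℝ, φ (s + t) = φ s * φ t)
    (hφinj : Function.Injective φ)
    (hφmono : ∀ s t : ℝ, s ≤ t → r (φ s) (φ t))
    (horder : ∀ x y, r x y → r y x → x = y)
    (hcof : ∀ ψ : G, ∃ s t : ℝ, r (φ s) ψ ∧ r ψ (φ t)) :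
    (∀ x : G, dSpec r φ x x = 0) ∧
    (∀ x y : G, 0 ≤ dSpec r φ x y) ∧
    (∀ x y : G, dSpec r φ x y = dSpec r φ y x) ∧
    (∀ x y z : G, dSpec r φ x z ≤ dSpec r φ x y + dSpec r φ y z) ∧
    (∀ g x y : G, dSpec r φ (x * g) (y * g) = dSpec r φ x y) ∧
    (∀ a b c : G, r a b → r b c → dSpec r φ a b ≤ dSpec r φ a c) := by
  have hbdd := bddBelow_setOf_rel_flow htrans hφinj hφmono horder hcof
  have hne : ∀ ψ, {t : ℝ | r ψ (φ t)}.Nonempty := fun ψ =>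
    let ⟨_, t, _, ht⟩ := hcof ψ
    ⟨t, ht⟩
  have hone : cplus r φ 1 = 0 := by
    have h0 : φ 0 = 1 := by simpa using hφadd 0 0
    rw [← h0, cplus_flow hφinj hφmono horder]
  have hmul := cplus_mul_le htrans hbi hφadd hbdd hne
  have hmono : ∀ {x y : G}, r x y → cplus r φ x ≤ cplus r φ y := cplus_mono htrans hbdd hne
  have hright : ∀ {x y : G} (g : G), r x y → r (x * g) (y * g) := fun g h => by
    simpa using hbi 1 g _ _ h
  refine ⟨fun x => by simp [dSpec, hone], fun x y => ?_, fun x y => max_comm _ _,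
    fun x y z => ?_, fun g x y => by simp [dSpec, mul_assoc], fun a b c hab hbc => ?_⟩
  · have h := hmul (x * y⁻¹) (y * x⁻¹)
    simp only [inv_mul_cancel_left, mul_assoc, mul_inv_cancel, hone] at h
    rw [dSpec, le_max_iff]
    by_contra! hlt
    linarith
  · have hxz := hmul (x * y⁻¹) (y * z⁻¹)
    have hzx := hmul (z * y⁻¹) (y * x⁻¹)
    rw [mul_assoc x, inv_mul_cancel_left] at hxz
    rw [mul_assoc z, inv_mul_cancel_left] at hzx
    refine max_le (hxz.trans (add_le_add (le_max_left _ _) (le_max_left _ _))) ?_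
    rw [add_comm] at hzx
    exact hzx.trans (add_le_add (le_max_right _ _) (le_max_right _ _))
  · refine le_max_of_le_right (max_le ?_ (hmono (hright _ hbc)))
    have hab' : cplus r φ (a * b⁻¹) ≤ cplus r φ 1 := hmono (by simpa using hright b⁻¹ hab)
    have hac : cplus r φ 1 ≤ cplus r φ (c * a⁻¹) :=
      hmono (by simpa using hright a⁻¹ (htrans _ _ _ hab hbc))
    exact hab'.trans hac
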